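/- Let n ≥ 2, let m_1,…,m_n be real constants, and let x : ℝ → ℝ^n be a differentiable curve such that x_1(t) < x_2(t) < ⋯ < x_n(t) for all t ∈ ℝ and such that for each 1 ≤ j ≤ n and all t, dx_j/dt = 2 Σ_{k≠j} m_j m_k e^{−|x_j(t)−x_k(t)|} + 4 Σ_{1≤i<j<k≤n} m_i m_k e^{−|x_i(t)−x_k(t)|}. Then for every 1 ≤ j ≤ ⌊n/2⌋, the function t ↦ H_j(x(t)) is constant, where H_j(x) = Σ_{I<J} (Π_{i∈I} m_i e^{x_i}) (Π_{k∈J} m_k e^{−x_k}), the sum running over pairs of j-element subsets I, J of {1,…,n} with I < J (interlacing). -/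

import Mathlib

open scoped Classical
open Finset

/-- The Poisson bracket `{f,g}(x) = ∑_{i<k} sgn(x_i - x_k)
(∂f/∂x_i ∂g/∂x_k - ∂f/∂x_k ∂g/∂x_i)` on `ℝ^n`. -/
noncomputable def pb {n : ℕ} (f g : (Fin n → ℝ) → ℝ) (x : Fin n → ℝ) : ℝ :=
  ∑ i : Fin n, ∑ k : Fin n,
    if i < k then
      Real.sign (x i - x k) *
        (fderiv ℝ f x (Pi.single i 1) * fderiv ℝ g x (Pi.single k 1) -
         fderiv ℝ f x (Pi.single k 1) * fderiv ℝ g x (Pi.single i 1))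
    else 0

/-- The `l`-th element (0-based) of a finset, in increasing order. -/
def elt {n : ℕ} (I : Finset (Fin n)) (l : ℕ) (h : l < I.card) : Fin n :=
  I.orderEmbOfFin rfl ⟨l, h⟩

/-- `I < J` (interlacing): writing `I = {i₁ < i₂ < ⋯}` and `J = {j₁ < j₂ < ⋯}`,
we require `i₁ < j₁ < i₂ < j₂ < ⋯`. -/
def Interlaces {n : ℕ} (I J : Finset (Fin n)) : Prop :=
  (∀ l (hI : l < I.card) (hJ : l < J.card), elt I l hI < elt J l hJ) ∧
  (∀ l (hJ : l < J.card) (hI : l + 1 < I.card), elt J l hJ < elt I (l + 1) hI)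

/-- `Hfun n j m x = H_j(x) = ∑_{I<J, |I|=|J|=j} (∏_{i∈I} mᵢ e^{xᵢ})(∏_{k∈J} mₖ e^{-xₖ})`. -/
noncomputable def Hfun (n j : ℕ) (m : Fin n → ℝ) (x : Fin n → ℝ) : ℝ :=
  ∑ I : Finset (Fin n), ∑ J : Finset (Fin n),
    if I.card = j ∧ J.card = j ∧ Interlaces I J then
      (∏ i ∈ I, m i * Real.exp (x i)) * (∏ k ∈ J, m k * Real.exp (-x k))
    else 0

section Interlacing

variable {n : ℕ}

theorem elt_mem (I : Finset (Fin n)) (l : ℕ) (h : l < I.card) : elt I l h ∈ I :=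
  Finset.orderEmbOfFin_mem _ _ _

/-- Adjoining a new maximum `k` to `J` appends `k` to the increasing enumeration of `J`. -/
theorem elt_insert {J : Finset (Fin n)} {k : Fin n} (hk : ∀ i ∈ J, i < k) (l : ℕ)
    (h : l < (insert k J).card) :
    elt (insert k J) l h = if h' : l < J.card then elt J l h' else k := by
  have hkJ : k ∉ J := fun hmem => lt_irrefl _ (hk k hmem)
  have hcard : (insert k J).card = J.card + 1 := Finset.card_insert_of_notMem hkJ
  have key := Finset.orderEmbOfFin_unique (s := insert k J) rfl
    (f := fun y => if h' : y.1 < J.card then elt J y.1 h' else k) ?_ ?_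
  · exact (congrFun key ⟨l, h⟩).symm
  · intro y
    split_ifs with h'
    · exact Finset.mem_insert_of_mem (elt_mem _ _ _)
    · exact Finset.mem_insert_self _ _
  · intro y z hyz
    have hyz' : y.1 < z.1 := hyz
    have hz := z.2
    dsimp only
    split_ifs with h1 h2 h2
    · exact (J.orderEmbOfFin rfl).strictMono (Fin.mk_lt_mk.2 hyz')
    · exact hk _ (elt_mem _ _ _)
    · omega
    · omega

theorem elt_insert_of_lt {J : Finset (Fin n)} {k : Fin n} (hk : ∀ i ∈ J, i < k) {l : ℕ}
    (h : l < (insert k J).card) (h' : l < J.card) : elt (insert k J) l h = elt J l h' := by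
  rw [elt_insert hk, dif_pos h']

theorem elt_insert_of_ge {J : Finset (Fin n)} {k : Fin n} (hk : ∀ i ∈ J, i < k) {l : ℕ}
    (h : l < (insert k J).card) (h' : J.card ≤ l) : elt (insert k J) l h = k := by
  rw [elt_insert hk, dif_neg (by omega)]

variable {I J : Finset (Fin n)} {k : Fin n}

theorem card_insert_max (hI : ∀ i ∈ I, i < k) : (insert k I).card = I.card + 1 :=
  Finset.card_insert_of_notMem fun hmem => lt_irrefl _ (hI k hmem)

theorem interlaces_insert_right_iff (hI : ∀ i ∈ I, i < k) (hJ : ∀ i ∈ J, i < k)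
    (hc : I.card = J.card + 1) : Interlaces I (insert k J) ↔ Interlaces I J := by
  have hcard := card_insert_max hJ
  constructor
  · rintro ⟨h1, h2⟩
    refine ⟨fun l hl hl' => ?_, fun l hl hl' => ?_⟩
    · have := h1 l hl (by omega)
      rwa [elt_insert_of_lt hJ _ hl'] at this
    · have := h2 l (by omega) hl'
      rwa [elt_insert_of_lt hJ _ hl] at this
  · rintro ⟨h1, h2⟩
    refine ⟨fun l hl hl' => ?_, fun l hl hl' => ?_⟩
    · by_cases h : l < J.card
      · simpa [elt_insert_of_lt hJ _ h] using h1 l hl h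
      · simpa [elt_insert_of_ge hJ _ (not_lt.1 h)] using hI _ (elt_mem _ _ hl)
    · have h : l < J.card := by omega
      simpa [elt_insert_of_lt hJ _ h] using h2 l h hl'

theorem interlaces_insert_left_iff (hI : ∀ i ∈ I, i < k) (hJ : ∀ i ∈ J, i < k)
    (hc : I.card = J.card) : Interlaces (insert k I) J ↔ Interlaces I J := by
  have hcard := card_insert_max hI
  constructor
  · rintro ⟨h1, h2⟩
    refine ⟨fun l hl hl' => ?_, fun l hl hl' => ?_⟩
    · have := h1 l (by omega) hl'
      rwa [elt_insert_of_lt hI _ hl] at this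
    · have := h2 l hl (by omega)
      rwa [elt_insert_of_lt hI _ hl'] at this
  · rintro ⟨h1, h2⟩
    refine ⟨fun l hl hl' => ?_, fun l hl hl' => ?_⟩
    · have h : l < I.card := by omega
      simpa [elt_insert_of_lt hI _ h] using h1 l h hl'
    · by_cases h : l + 1 < I.card
      · simpa [elt_insert_of_lt hI _ h] using h2 l hl h
      · simpa [elt_insert_of_ge hI _ (not_lt.1 h)] using hJ _ (elt_mem _ _ hl)

/-- The maximum of `I ∪ J` is not in `I` when `I` and `J` interlace and have the same size. -/
theorem not_interlaces_insert_left (hI : ∀ i ∈ I, i < k) (hJ : ∀ i ∈ J, i ≤ k)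
    (hc : (insert k I).card = J.card) : ¬ Interlaces (insert k I) J := by
  have hcard := card_insert_max hI
  rintro ⟨h1, -⟩
  have := h1 I.card (by omega) (by omega)
  rw [elt_insert_of_ge hI _ le_rfl] at this
  exact (hJ _ (elt_mem _ _ _)).not_gt this

/-- The maximum of `I ∪ J` is not in `J` when `I` and `J` interlace and `I` is larger than `J`. -/
theorem not_interlaces_insert_right (hI : ∀ i ∈ I, i ≤ k) (hJ : ∀ i ∈ J, i < k)
    (hc : I.card = (insert k J).card + 1) : ¬ Interlaces I (insert k J) := by
  have hcard := card_insert_max hJ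
  rintro ⟨-, h2⟩
  have := h2 J.card (by omega) (by omega)
  rw [elt_insert_of_ge hJ _ le_rfl] at this
  exact (hI _ (elt_mem _ _ _)).not_gt this

end Interlacing

section InterlacingSums

variable {n : ℕ} (a b : Fin n → ℝ)

/-- The sum of `(∏_{i∈I} aᵢ)(∏_{k∈J} bₖ)` over interlacing `I, J ⊆ S` with `|I| = p`, `|J| = q`. -/
noncomputable def interlacingSum (S : Finset (Fin n)) (p q : ℕ) : ℝ :=
  ∑ I ∈ S.powerset, ∑ J ∈ S.powerset,
    if I.card = p ∧ J.card = q ∧ Interlaces I J then (∏ i ∈ I, a i) * ∏ k ∈ J, b k else 0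

variable {a b} {S : Finset (Fin n)} {k : Fin n}

theorem interlacingSum_insert (hk : ∀ i ∈ S, i < k) (p q : ℕ) :
    interlacingSum a b (insert k S) p q = interlacingSum a b S p q +
      ∑ I ∈ S.powerset, ∑ J ∈ S.powerset,
       ((if I.card = p ∧ J.card + 1 = q ∧ Interlaces I (insert k J) then
          (∏ i ∈ I, a i) * (b k * ∏ k ∈ J, b k) else 0) +
        (if I.card + 1 = p ∧ J.card = q ∧ Interlaces (insert k I) J then
          (a k * ∏ i ∈ I, a i) * ∏ k ∈ J, b k else 0) +
        (if I.card + 1 = p ∧ J.card + 1 = q ∧ Interlaces (insert k I) (insert k J) then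
          (a k * ∏ i ∈ I, a i) * (b k * ∏ k ∈ J, b k) else 0)) := by
  have hkS : k ∉ S := fun h => lt_irrefl _ (hk k h)
  have hlt : ∀ {I}, I ∈ S.powerset → ∀ i ∈ I, i < k := fun hI i hi =>
    hk i (Finset.mem_powerset.1 hI hi)
  have hnot : ∀ {I}, I ∈ S.powerset → k ∉ I := fun hI h => lt_irrefl _ (hlt hI k h)
  unfold interlacingSum
  simp only [Finset.sum_powerset_insert hkS, ← Finset.sum_add_distrib]
  refine Finset.sum_congr rfl fun I hI => Finset.sum_congr rfl fun J hJ => ?_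
  rw [card_insert_max (hlt hI), card_insert_max (hlt hJ), Finset.prod_insert (hnot hI),
    Finset.prod_insert (hnot hJ)]
  ring

theorem interlacingSum_insert_even (hk : ∀ i ∈ S, i < k) (j : ℕ) :
    interlacingSum a b (insert k S) (j + 1) (j + 1) =
      interlacingSum a b S (j + 1) (j + 1) + b k * interlacingSum a b S (j + 1) j := by
  rw [interlacingSum_insert hk]
  congr 1
  rw [interlacingSum, Finset.mul_sum]
  refine Finset.sum_congr rfl fun I hI => ?_
  rw [Finset.mul_sum]
  refine Finset.sum_congr rfl fun J hJ => ?_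
  have hI' : ∀ i ∈ I, i < k := fun i hi => hk i (Finset.mem_powerset.1 hI hi)
  have hJ' : ∀ i ∈ J, i < k := fun i hi => hk i (Finset.mem_powerset.1 hJ hi)
  have hJk : ∀ i ∈ insert k J, i ≤ k := by
    simpa using fun i hi => (hJ' i hi).le
  rw [if_neg (c := I.card + 1 = j + 1 ∧ J.card = j + 1 ∧ _), if_neg (c := I.card + 1 = j + 1 ∧ _)]
  · have : (I.card = j + 1 ∧ J.card + 1 = j + 1 ∧ Interlaces I (insert k J)) ↔
        (I.card = j + 1 ∧ J.card = j ∧ Interlaces I J) := by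
      constructor
      · rintro ⟨h1, h2, h3⟩
        exact ⟨h1, by omega, (interlaces_insert_right_iff hI' hJ' (by omega)).1 h3⟩
      · rintro ⟨h1, h2, h3⟩
        exact ⟨h1, by omega, (interlaces_insert_right_iff hI' hJ' (by omega)).2 h3⟩
    simp only [this]
    split_ifs <;> ring
  · rintro ⟨h1, h2, h3⟩
    exact not_interlaces_insert_left hI' hJk
      (by rw [card_insert_max hI', card_insert_max hJ']; omega) h3
  · rintro ⟨h1, h2, h3⟩
    exact not_interlaces_insert_left hI' (fun i hi => (hJ' i hi).le)
      (by rw [card_insert_max hI']; omega) h3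

theorem interlacingSum_insert_odd (hk : ∀ i ∈ S, i < k) (j : ℕ) :
    interlacingSum a b (insert k S) (j + 1) j =
      interlacingSum a b S (j + 1) j + a k * interlacingSum a b S j j := by
  rw [interlacingSum_insert hk]
  congr 1
  rw [interlacingSum, Finset.mul_sum]
  refine Finset.sum_congr rfl fun I hI => ?_
  rw [Finset.mul_sum]
  refine Finset.sum_congr rfl fun J hJ => ?_
  have hI' : ∀ i ∈ I, i < k := fun i hi => hk i (Finset.mem_powerset.1 hI hi)
  have hJ' : ∀ i ∈ J, i < k := fun i hi => hk i (Finset.mem_powerset.1 hJ hi)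
  have hIk : ∀ i ∈ insert k I, i ≤ k := by
    simpa using fun i hi => (hI' i hi).le
  rw [if_neg (c := I.card = j + 1 ∧ J.card + 1 = j ∧ _),
    if_neg (c := I.card + 1 = j + 1 ∧ J.card + 1 = j ∧ _)]
  · have : (I.card + 1 = j + 1 ∧ J.card = j ∧ Interlaces (insert k I) J) ↔
        (I.card = j ∧ J.card = j ∧ Interlaces I J) := by
      constructor
      · rintro ⟨h1, h2, h3⟩
        exact ⟨by omega, h2, (interlaces_insert_left_iff hI' hJ' (by omega)).1 h3⟩
      · rintro ⟨h1, h2, h3⟩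
        exact ⟨by omega, h2, (interlaces_insert_left_iff hI' hJ' (by omega)).2 h3⟩
    simp only [this]
    split_ifs <;> ring
  · rintro ⟨h1, h2, h3⟩
    exact not_interlaces_insert_right hIk hJ'
      (by rw [card_insert_max hI', card_insert_max hJ']; omega) h3
  · rintro ⟨h1, h2, h3⟩
    exact not_interlaces_insert_right (fun i hi => (hI' i hi).le) hJ'
      (by rw [card_insert_max hJ']; omega) h3

theorem interlacingSum_zero_zero (S : Finset (Fin n)) : interlacingSum a b S 0 0 = 1 := by
  have h : Interlaces (∅ : Finset (Fin n)) ∅ := ⟨by simp, by simp⟩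
  rw [interlacingSum, Finset.sum_eq_single_of_mem ∅ (by simp),
    Finset.sum_eq_single_of_mem ∅ (by simp)]
  · simp [h]
  · intro J _ hJ
    simp [hJ]
  · intro I _ hI
    simp [hI]

theorem interlacingSum_empty_of_pos (p q : ℕ) : interlacingSum a b ∅ (p + 1) q = 0 := by
  simp [interlacingSum]

theorem Hfun_eq_interlacingSum (j : ℕ) (m x : Fin n → ℝ) :
    Hfun n j m x = interlacingSum (fun i => m i * Real.exp (x i))
      (fun i => m i * Real.exp (-x i)) univ j j := by
  simp [Hfun, interlacingSum]

end InterlacingSums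

section InitialSegments

variable {n : ℕ}

/-- The first `k` elements of `Fin n`. -/
def initialSegment (n k : ℕ) : Finset (Fin n) := univ.filter fun i => i.1 < k

/-- All but the first `k` elements of `Fin n`. -/
def finalSegment (n k : ℕ) : Finset (Fin n) := univ.filter fun i => k ≤ i.1

theorem initialSegment_succ (k : Fin n) :
    initialSegment n (k.1 + 1) = insert k (initialSegment n k.1) := by
  ext i
  simp only [initialSegment, Finset.mem_filter, Finset.mem_univ, true_and, Finset.mem_insert,
    Fin.ext_iff]
  omega

theorem finalSegment_eq_insert (k : Fin n) :
    finalSegment n k.1 = insert k (finalSegment n (k.1 + 1)) := by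
  ext i
  simp only [finalSegment, Finset.mem_filter, Finset.mem_univ, true_and, Finset.mem_insert,
    Fin.ext_iff]
  omega

theorem lt_of_mem_initialSegment {k i : Fin n} (hi : i ∈ initialSegment n k.1) : i < k := by
  simpa [initialSegment] using hi

theorem sum_initialSegment_succ (f : Fin n → ℝ) (k : Fin n) :
    ∑ i ∈ initialSegment n (k.1 + 1), f i = f k + ∑ i ∈ initialSegment n k.1, f i := by
  rw [initialSegment_succ, Finset.sum_insert (by simp [initialSegment])]

theorem sum_finalSegment (f : Fin n → ℝ) (k : Fin n) :
    ∑ i ∈ finalSegment n k.1, f i = f k + ∑ i ∈ finalSegment n (k.1 + 1), f i := by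
  rw [finalSegment_eq_insert, Finset.sum_insert (by simp [finalSegment])]

theorem interlacingSum_one_zero {a b : Fin n → ℝ} {k : ℕ} (hk : k ≤ n) :
    interlacingSum a b (initialSegment n k) 1 0 = ∑ i ∈ initialSegment n k, a i := by
  induction k with
  | zero => simp [initialSegment, interlacingSum_empty_of_pos]
  | succ k ih =>
    have h1 := sum_initialSegment_succ a ⟨k, hk⟩
    have h2 := initialSegment_succ (⟨k, hk⟩ : Fin n)
    have h3 := interlacingSum_insert_odd (a := a) (b := b) (k := (⟨k, hk⟩ : Fin n))
      (fun i hi => lt_of_mem_initialSegment hi) 0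
    simp only at h1 h2 h3
    rw [h1, h2, h3, ih (by omega), interlacingSum_zero_zero]
    ring

/-- The velocity of the peakon at position `j`, in terms of `aᵢ = mᵢ e^{xᵢ}`, `bᵢ = mᵢ e^{-xᵢ}`. -/
theorem peakon_velocity_eq {m x : Fin n → ℝ} (hx : StrictMono x) (j : Fin n) :
    2 * ∑ k ∈ univ.erase j, m j * m k * Real.exp (-|x j - x k|) +
      4 * ∑ i : Fin n, ∑ k : Fin n,
        (if i < j ∧ j < k then m i * m k * Real.exp (-|x i - x k|) else 0) =
    2 * ((∑ i ∈ initialSegment n j.1, m i * Real.exp (x i)) *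
          (∑ i ∈ finalSegment n j.1, m i * Real.exp (-x i)) +
        (∑ i ∈ initialSegment n (j.1 + 1), m i * Real.exp (x i)) *
          (∑ i ∈ finalSegment n (j.1 + 1), m i * Real.exp (-x i))) := by
  have hexp : ∀ {i k}, i < k → m i * m k * Real.exp (-|x i - x k|) =
      (m i * Real.exp (x i)) * (m k * Real.exp (-x k)) := by
    intro i k hik
    rw [abs_of_neg (sub_neg.2 (hx hik)), neg_neg, sub_eq_add_neg, Real.exp_add]
    ring
  have herase : univ.erase j = initialSegment n j.1 ∪ finalSegment n (j.1 + 1) := by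
    ext i
    simp only [initialSegment, finalSegment, Finset.mem_erase, Finset.mem_union,
      Finset.mem_filter, Finset.mem_univ, true_and, and_true, ne_eq, Fin.ext_iff]
    omega
  have hdisj : Disjoint (initialSegment n j.1) (finalSegment n (j.1 + 1)) := by
    rw [Finset.disjoint_left]
    simp only [initialSegment, finalSegment, Finset.mem_filter, Finset.mem_univ, true_and]
    omega
  have hleft : ∑ k ∈ initialSegment n j.1, m j * m k * Real.exp (-|x j - x k|) =
      (∑ i ∈ initialSegment n j.1, m i * Real.exp (x i)) * (m j * Real.exp (-x j)) := by
    rw [Finset.sum_mul]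
    refine Finset.sum_congr rfl fun k hk => ?_
    rw [abs_sub_comm, mul_comm (m j), hexp (lt_of_mem_initialSegment hk)]
  have hright : ∑ k ∈ finalSegment n (j.1 + 1), m j * m k * Real.exp (-|x j - x k|) =
      (m j * Real.exp (x j)) * ∑ i ∈ finalSegment n (j.1 + 1), m i * Real.exp (-x i) := by
    rw [Finset.mul_sum]
    refine Finset.sum_congr rfl fun k hk => hexp ?_
    simpa [finalSegment, Nat.succ_le_iff] using hk
  have hdouble : ∑ i : Fin n, ∑ k : Fin n,
        (if i < j ∧ j < k then m i * m k * Real.exp (-|x i - x k|) else 0) =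
      (∑ i ∈ initialSegment n j.1, m i * Real.exp (x i)) *
        ∑ i ∈ finalSegment n (j.1 + 1), m i * Real.exp (-x i) := by
    rw [Finset.sum_mul_sum, initialSegment, Finset.sum_filter]
    refine Finset.sum_congr rfl fun i _ => ?_
    simp only [Fin.val_fin_lt]
    split_ifs with hi
    · rw [finalSegment, Finset.sum_filter]
      refine Finset.sum_congr rfl fun k _ => ?_
      simp only [Nat.succ_le_iff, Fin.val_fin_lt, hi, true_and]
      split_ifs with hk
      · exact hexp (hi.trans hk)
      · rfl
    · simp [hi]
  rw [herase, Finset.sum_union hdisj, hleft, hright, hdouble, sum_initialSegment_succ,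
    sum_finalSegment]
  ring

end InitialSegments

/-- The evolution of the interlacing sums over initial segments, when each `a i` grows at rate `c i`
and each `b i` decays at rate `c i`, where `c` is the peakon velocity: this is the zero-curvature
form of the peakon equations, read off coefficientwise. -/
theorem hasDerivAt_interlacingSum {n : ℕ} {a b : ℝ → Fin n → ℝ} {c : Fin n → ℝ} {t : ℝ}
    (ha : ∀ i, HasDerivAt (fun s => a s i) (c i * a t i) t)
    (hb : ∀ i, HasDerivAt (fun s => b s i) (-c i * b t i) t)
    (hc : ∀ k : Fin n, c k = 2 *
      ((∑ i ∈ initialSegment n k.1, a t i) * (∑ i ∈ finalSegment n k.1, b t i) +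
       (∑ i ∈ initialSegment n (k.1 + 1), a t i) * (∑ i ∈ finalSegment n (k.1 + 1), b t i)))
    {k : ℕ} (hk : k ≤ n) :
    (∀ j, HasDerivAt (fun s => interlacingSum (a s) (b s) (initialSegment n k) j j)
      (2 * (∑ i ∈ finalSegment n k, b t i) *
          interlacingSum (a t) (b t) (initialSegment n k) (j + 1) j -
        2 * ((∑ i ∈ initialSegment n k, a t i) * ∑ i ∈ finalSegment n k, b t i) *
          interlacingSum (a t) (b t) (initialSegment n k) j j) t) ∧
    (∀ j, HasDerivAt (fun s => interlacingSum (a s) (b s) (initialSegment n k) (j + 1) j)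
      (2 * (∑ i ∈ initialSegment n k, a t i) *
          interlacingSum (a t) (b t) (initialSegment n k) (j + 1) (j + 1) +
        2 * ((∑ i ∈ initialSegment n k, a t i) * ∑ i ∈ finalSegment n k, b t i) *
          interlacingSum (a t) (b t) (initialSegment n k) (j + 1) j -
        2 * interlacingSum (a t) (b t) (initialSegment n k) (j + 2) (j + 1)) t) := by
  induction k with
  | zero =>
    have h0 : initialSegment n 0 = ∅ := by simp [initialSegment]
    refine ⟨fun j => ?_, fun j => ?_⟩
    · rcases j with _ | j
      · simpa [h0, interlacingSum_zero_zero, interlacingSum_empty_of_pos] using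
          hasDerivAt_const t (1 : ℝ)
      · simpa [h0, interlacingSum_empty_of_pos] using hasDerivAt_const t (0 : ℝ)
    · simpa [h0, interlacingSum_empty_of_pos] using hasDerivAt_const t (0 : ℝ)
  | succ k ih =>
    obtain ⟨ihe, iho⟩ := ih (by omega)
    obtain ⟨κ, rfl⟩ : ∃ κ : Fin n, κ.1 = k := ⟨⟨k, hk⟩, rfl⟩
    have hlt : ∀ i ∈ initialSegment n κ.1, i < κ := fun i hi => lt_of_mem_initialSegment hi
    have hc' := hc κ
    have hB := sum_finalSegment (b t) κ
    have hA := sum_initialSegment_succ (a t) κ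
    refine ⟨fun j => ?_, fun j => ?_⟩
    · rcases j with _ | j
      · have := interlacingSum_one_zero (a := a t) (b := b t) hk
        simp only [interlacingSum_zero_zero, zero_add, this]
        refine (hasDerivAt_const t (1 : ℝ)).congr_deriv ?_
        ring
      · simp only [initialSegment_succ κ, interlacingSum_insert_even hlt,
          interlacingSum_insert_odd hlt]
        refine ((ihe (j + 1)).add ((hb κ).mul (iho j))).congr_deriv ?_
        rw [← initialSegment_succ κ, hc', hB, hA]
        ring
    · simp only [initialSegment_succ κ, interlacingSum_insert_even hlt,
        interlacingSum_insert_odd hlt]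
      refine ((iho j).add ((ha κ).mul (ihe j))).congr_deriv ?_
      rw [← initialSegment_succ κ, hc', hB, hA]
      ring

theorem statement14 (n : ℕ) (hn : 2 ≤ n) (m : Fin n → ℝ) (x : ℝ → Fin n → ℝ)
    (hord : ∀ t : ℝ, StrictMono (x t))
    (hode : ∀ (j : Fin n) (t : ℝ),
      HasDerivAt (fun s => x s j)
        (2 * ∑ k ∈ Finset.univ.erase j, m j * m k * Real.exp (-|x t j - x t k|) +
         4 * ∑ i : Fin n, ∑ k : Fin n,
            if i < j ∧ j < k then m i * m k * Real.exp (-|x t i - x t k|) else 0) t)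
    (j : ℕ) (hj : 1 ≤ j) (hj' : j ≤ n / 2) (t s : ℝ) :
    Hfun n j m (x t) = Hfun n j m (x s) := by
  have hderiv : ∀ t, HasDerivAt (fun s => Hfun n j m (x s)) 0 t := by
    intro t
    have hode' := fun i => hode i t
    simp only [peakon_velocity_eq (hord t)] at hode'
    have key := (hasDerivAt_interlacingSum (t := t)
      (a := fun s i => m i * Real.exp (x s i)) (b := fun s i => m i * Real.exp (-x s i))
      (fun i => by
        refine ((hode' i).exp.const_mul (m i)).congr_deriv ?_
        ring)
      (fun i => by
        refine ((hode' i).neg.exp.const_mul (m i)).congr_deriv ?_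
        simp only [Pi.neg_apply]
        ring)
      (fun _ => rfl) le_rfl).1 j
    have hi : initialSegment n n = univ := by simp [initialSegment]
    have hf : finalSegment n n = ∅ := by simp [finalSegment]
    simpa [hi, hf, Hfun_eq_interlacingSum] using key
  exact is_const_of_deriv_eq_zero (fun t => (hderiv t).differentiableAt)
    (fun t => (hderiv t).deriv) t s
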